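/- arXiv:2207.03438 — 3 statements merged into one kernel-verified Lean document; each statement's English description precedes it below -/
import Mathlib

section
/- For any initial balance x with 0 < x ≤ x*, the strategy α*(t) := M(t) for all t ∈ [0,T] attains the infimum defining v(x) (i.e. J(x, α*) = v(x)), and v(x) = v2(x), where t_M = t_M(x) ∈ (0,T] is the unique solution of x = ∫_0^{t_M} e^{−(r+β)s} M(s) ds and v2(x) := ∫_0^{t_M(x)} e^{−rs} M(s) ds. -/
open MeasureTheory Set

noncomputable section

/-- Admissible repayment strategies: measurable, with `m t ≤ α t ≤ M t` on `[0,T]`. -/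
def Adm (T : ℝ) (m M : ℝ → ℝ) : Set (ℝ → ℝ) :=
  {α | Measurable α ∧ ∀ t ∈ Icc (0:ℝ) T, m t ≤ α t ∧ α t ≤ M t}

/-- Compound-interest balance. -/
def balC (r β x : ℝ) (α : ℝ → ℝ) (t : ℝ) : ℝ :=
  Real.exp ((r + β) * t) * (x - ∫ s in (0:ℝ)..t, Real.exp (-(r + β) * s) * α s)

/-- Terminal time: first zero of the balance in `[0,T]`, capped at `T`. -/
def tauC (r β T x : ℝ) (α : ℝ → ℝ) : ℝ :=
  sInf (insert T {t | t ∈ Icc (0:ℝ) T ∧ balC r β x α t = 0})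

/-- Repayment cost. -/
def costC (r β T ω x : ℝ) (α : ℝ → ℝ) : ℝ :=
  (∫ t in (0:ℝ)..(tauC r β T x α), Real.exp (-r * t) * α t)
    + ω * Real.exp (-r * tauC r β T x α) * balC r β x α (tauC r β T x α)

/-- Value function. -/
def valC (r β T ω : ℝ) (m M : ℝ → ℝ) (x : ℝ) : ℝ :=
  sInf (costC r β T ω x '' Adm T m M)

/-- Critical horizon `t_c = max(T + log ω / β, 0)`. -/
def tCrit (β T ω : ℝ) : ℝ := max (T + Real.log ω / β) 0

/-- The cost `v₁` of the max-min strategy. -/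
def vOne (r β T ω : ℝ) (m M : ℝ → ℝ) (x : ℝ) : ℝ :=
  (∫ s in (0:ℝ)..(tCrit β T ω), Real.exp (-r * s) * M s)
  + (∫ s in (tCrit β T ω)..T, Real.exp (-r * s) * m s)
  + ω * Real.exp (β * T) *
    (x - (∫ s in (0:ℝ)..(tCrit β T ω), Real.exp (-(r + β) * s) * M s)
       - ∫ s in (tCrit β T ω)..T, Real.exp (-(r + β) * s) * m s)

/-- `x̂ = ∫_0^{t_c} e^{-(r+β)s} M(s) ds`. -/
def xHat (r β T ω : ℝ) (M : ℝ → ℝ) : ℝ :=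
  ∫ s in (0:ℝ)..(tCrit β T ω), Real.exp (-(r + β) * s) * M s

/-- `x̄ = ∫_0^T e^{-(r+β)s} M(s) ds`. -/
def xBar (r β T : ℝ) (M : ℝ → ℝ) : ℝ :=
  ∫ s in (0:ℝ)..T, Real.exp (-(r + β) * s) * M s

/-- `x̲ = ∫_0^T e^{-(r+β)s} m(s) ds`. -/
def xLow (r β T : ℝ) (m : ℝ → ℝ) : ℝ :=
  ∫ s in (0:ℝ)..T, Real.exp (-(r + β) * s) * m s

/-- `x_c = ∫_0^{t_c} e^{-(r+β)s} M(s) ds + ∫_{t_c}^T e^{-(r+β)s} m(s) ds`. -/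
def xCrit (r β T ω : ℝ) (m M : ℝ → ℝ) : ℝ :=
  xHat r β T ω M + ∫ s in (tCrit β T ω)..T, Real.exp (-(r + β) * s) * m s

/-- A continuous weight preserves integrability on subintervals. -/
lemma intervalIntegrable_continuous_mul {T : ℝ} {f h : ℝ → ℝ} (hf : IntegrableOn f (Icc 0 T))
    (hh : Continuous h) {a b : ℝ} (ha : a ∈ Icc 0 T) (hb : b ∈ Icc 0 T) :
    IntervalIntegrable (fun s => h s * f s) volume a b := by
  have hf' : IntervalIntegrable f volume a b :=
    (hf.mono_set (uIcc_subset_Icc ha hb)).intervalIntegrable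
  exact hf'.continuousOn_mul hh.continuousOn

lemma Adm.integrableOn {T : ℝ} {m M α : ℝ → ℝ} (hMInt : IntegrableOn M (Icc 0 T))
    (hm : ∀ t ∈ Icc (0:ℝ) T, 0 < m t) (hα : α ∈ Adm T m M) : IntegrableOn α (Icc 0 T) := by
  refine Integrable.mono' hMInt hα.1.aestronglyMeasurable ?_
  filter_upwards [ae_restrict_mem measurableSet_Icc] with t ht
  rw [Real.norm_eq_abs, abs_of_pos ((hm t ht).trans_le (hα.2 t ht).1)]
  exact (hα.2 t ht).2

lemma continuousOn_discounted {T c : ℝ} (hT : 0 ≤ T) {α : ℝ → ℝ}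
    (hα : IntegrableOn α (Icc 0 T)) :
    ContinuousOn (fun t => ∫ s in (0:ℝ)..t, Real.exp (c * s) * α s) (Icc 0 T) := by
  have h := intervalIntegrable_continuous_mul (h := fun s => Real.exp (c * s)) hα (by fun_prop)
    (left_mem_Icc.2 hT) (right_mem_Icc.2 hT)
  rw [intervalIntegrable_iff_integrableOn_Icc_of_le hT, ← uIcc_of_le hT] at h
  rw [← uIcc_of_le hT]
  exact intervalIntegral.continuousOn_primitive_interval h

lemma balC_eq_zero_iff {r β x : ℝ} {α : ℝ → ℝ} {t : ℝ} :
    balC r β x α t = 0 ↔ ∫ s in (0:ℝ)..t, Real.exp (-(r + β) * s) * α s = x := by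
  rw [balC, mul_eq_zero, or_iff_right (Real.exp_pos _).ne', sub_eq_zero, eq_comm]

lemma tauC_le {r β T x : ℝ} (hT : 0 ≤ T) {α : ℝ → ℝ} {t : ℝ} (ht : t ∈ Icc 0 T)
    (h0 : balC r β x α t = 0) : tauC r β T x α ≤ t := by
  refine csInf_le ⟨0, ?_⟩ (Or.inr ⟨ht, h0⟩)
  rintro y (rfl | hy)
  exacts [hT, hy.1.1]

/-- The terminal time is either a zero of the balance, or the horizon with a positive balance. -/
lemma tauC_spec {r β T x : ℝ} (hT : 0 ≤ T) (hx : 0 < x) {α : ℝ → ℝ}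
    (hα : IntegrableOn α (Icc 0 T)) :
    (tauC r β T x α ∈ Icc 0 T ∧ balC r β x α (tauC r β T x α) = 0) ∨
      (tauC r β T x α = T ∧ ∫ s in (0:ℝ)..T, Real.exp (-(r + β) * s) * α s ≤ x) := by
  have hcont := continuousOn_discounted (c := -(r + β)) hT hα
  have hmem : tauC r β T x α ∈ insert T {t | t ∈ Icc (0:ℝ) T ∧ balC r β x α t = 0} := by
    refine IsClosed.csInf_mem ?_ (insert_nonempty _ _) ⟨0, ?_⟩
    · rw [insert_eq]
      refine isClosed_singleton.union ?_
      have := hcont.preimage_isClosed_of_isClosed isClosed_Icc (isClosed_singleton (x := x))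
      convert this using 1
      ext t
      simp only [mem_ofPred_eq, balC_eq_zero_iff, mem_inter_iff, mem_preimage, mem_singleton_iff]
    · rintro y (rfl | hy)
      exacts [hT, hy.1.1]
  by_cases hz : balC r β x α (tauC r β T x α) = 0
  · refine Or.inl ⟨?_, hz⟩
    rcases hmem with h | h
    · rw [h]; exact right_mem_Icc.2 hT
    · exact h.1
  · have hτ : tauC r β T x α = T := by
      rcases hmem with h | h
      · exact h
      · exact absurd h.2 hz
    refine Or.inr ⟨hτ, ?_⟩
    by_contra! hlt
    obtain ⟨t, ht, hte⟩ := intermediate_value_Icc hT hcont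
      (show x ∈ Icc _ _ from ⟨by simpa using hx.le, hlt.le⟩)
    have hle := tauC_le hT ht (balC_eq_zero_iff.2 hte)
    have : t = T := le_antisymm ht.2 (hτ ▸ hle)
    exact hlt.ne' (this ▸ hte)

/-- Paying at the maximal rate up to `a`, rather than following `α` up to `b`, saves at least
`e^{βa}` per unit of discounted repayment. -/
lemma rearrangement_le {r β T a b : ℝ} (hβ : 0 < β) {α M : ℝ → ℝ}
    (hαInt : IntegrableOn α (Icc 0 T)) (hMInt : IntegrableOn M (Icc 0 T))
    (hα0 : ∀ t ∈ Icc (0:ℝ) T, 0 ≤ α t) (hαM : ∀ t ∈ Icc (0:ℝ) T, α t ≤ M t)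
    (ha : 0 ≤ a) (hab : a ≤ b) (hb : b ≤ T) :
    Real.exp (β * a) * ((∫ s in (0:ℝ)..b, Real.exp (-(r + β) * s) * α s) -
        ∫ s in (0:ℝ)..a, Real.exp (-(r + β) * s) * M s) ≤
      (∫ s in (0:ℝ)..b, Real.exp (-r * s) * α s) -
        ∫ s in (0:ℝ)..a, Real.exp (-r * s) * M s := by
  have m0 : (0:ℝ) ∈ Icc 0 T := ⟨le_rfl, ha.trans (hab.trans hb)⟩
  have ma : a ∈ Icc 0 T := ⟨ha, hab.trans hb⟩
  have mb : b ∈ Icc 0 T := ⟨ha.trans hab, hb⟩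
  have hI : ∀ {f : ℝ → ℝ} (c : ℝ) {u v : ℝ}, IntegrableOn f (Icc 0 T) → u ∈ Icc 0 T →
      v ∈ Icc 0 T → IntervalIntegrable (fun s => Real.exp (c * s) * f s) volume u v :=
    fun c _ _ hf hu hv => intervalIntegrable_continuous_mul hf (by fun_prop) hu hv
  have hsplit : ∀ s, Real.exp (-r * s) = Real.exp (β * s) * Real.exp (-(r + β) * s) := by
    intro s
    rw [← Real.exp_add]
    ring_nf
  have hleft : (∫ s in (0:ℝ)..a, (Real.exp (β * a) * (Real.exp (-(r + β) * s) * α s) -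
        Real.exp (β * a) * (Real.exp (-(r + β) * s) * M s))) ≤
      ∫ s in (0:ℝ)..a, (Real.exp (-r * s) * α s - Real.exp (-r * s) * M s) := by
    refine intervalIntegral.integral_mono_on ha
      (((hI _ hαInt m0 ma).const_mul _).sub ((hI _ hMInt m0 ma).const_mul _))
      ((hI _ hαInt m0 ma).sub (hI _ hMInt m0 ma)) fun s hs => ?_
    have h1 : Real.exp (β * s) ≤ Real.exp (β * a) := by
      gcongr
      exact hs.2
    have h2 := hαM s ⟨hs.1, hs.2.trans ma.2⟩
    rw [hsplit]
    have := mul_nonneg (mul_nonneg (sub_nonneg.2 h1) (sub_nonneg.2 h2))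
      (Real.exp_pos (-(r + β) * s)).le
    linarith
  have hright : (∫ s in a..b, Real.exp (β * a) * (Real.exp (-(r + β) * s) * α s)) ≤
      ∫ s in a..b, Real.exp (-r * s) * α s := by
    refine intervalIntegral.integral_mono_on hab ((hI _ hαInt ma mb).const_mul _)
      (hI _ hαInt ma mb) fun s hs => ?_
    have h1 : Real.exp (β * a) ≤ Real.exp (β * s) := by
      gcongr
      exact hs.1
    have h2 := hα0 s ⟨ha.trans hs.1, hs.2.trans hb⟩
    rw [hsplit, mul_assoc]
    exact mul_le_mul_of_nonneg_right h1 (mul_nonneg (Real.exp_pos _).le h2)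
  rw [intervalIntegral.integral_sub ((hI _ hαInt m0 ma).const_mul _)
      ((hI _ hMInt m0 ma).const_mul _),
    intervalIntegral.integral_sub (hI _ hαInt m0 ma) (hI _ hMInt m0 ma),
    intervalIntegral.integral_const_mul, intervalIntegral.integral_const_mul] at hleft
  rw [intervalIntegral.integral_const_mul] at hright
  rw [← intervalIntegral.integral_add_adjacent_intervals (hI _ hαInt m0 ma) (hI _ hαInt ma mb),
    ← intervalIntegral.integral_add_adjacent_intervals (hI _ hαInt m0 ma) (hI _ hαInt ma mb)]
  linarith

lemma tCrit_nonneg (β T ω : ℝ) : 0 ≤ tCrit β T ω := le_max_right _ _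

lemma net_weight_nonneg_of_tCrit_le {β T ω s : ℝ} (hβ : 0 < β) (hω : 0 < ω) (hs : tCrit β T ω ≤ s) :
    0 ≤ 1 - ω * Real.exp (β * (T - s)) := by
  have h : T + Real.log ω / β ≤ s := (le_max_left _ _).trans hs
  have h' : Real.log ω ≤ (s - T) * β := (div_le_iff₀ hβ).1 (by linarith)
  have : ω * Real.exp (β * (T - s)) ≤ 1 := by
    nth_rewrite 1 [← Real.exp_log hω]
    rw [← Real.exp_add, Real.exp_le_one_iff]
    linarith
  linarith

lemma net_weight_nonpos_of_lt_tCrit {β T ω s : ℝ} (hβ : 0 < β) (hω : 0 < ω) (hs0 : 0 ≤ s)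
    (hs : s < tCrit β T ω) : 1 - ω * Real.exp (β * (T - s)) ≤ 0 := by
  have h : s < T + Real.log ω / β := (lt_max_iff.1 hs).resolve_right hs0.not_gt
  have h' : (s - T) * β < Real.log ω := (lt_div_iff₀ hβ).1 (by linarith)
  have : 1 ≤ ω * Real.exp (β * (T - s)) := by
    nth_rewrite 1 [← Real.exp_log hω]
    rw [← Real.exp_add, Real.one_le_exp_iff]
    linarith
  linarith

/-- The cost integral net of the terminal reward. -/
lemma integral_net_cost {r β T ω a b : ℝ} {f : ℝ → ℝ} (hf : IntegrableOn f (Icc 0 T))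
    (ha : a ∈ Icc 0 T) (hb : b ∈ Icc 0 T) :
    (∫ s in a..b, Real.exp (-r * s) * f s * (1 - ω * Real.exp (β * (T - s)))) =
      (∫ s in a..b, Real.exp (-r * s) * f s) -
        ω * Real.exp (β * T) * ∫ s in a..b, Real.exp (-(r + β) * s) * f s := by
  rw [← intervalIntegral.integral_const_mul, ← intervalIntegral.integral_sub
    (intervalIntegrable_continuous_mul hf (by fun_prop) ha hb)
    ((intervalIntegrable_continuous_mul hf (by fun_prop) ha hb).const_mul _)]
  congr 1
  ext s
  have : Real.exp (-r * s) * Real.exp (β * (T - s)) =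
      Real.exp (β * T) * Real.exp (-(r + β) * s) := by
    rw [← Real.exp_add, ← Real.exp_add]
    ring_nf
  linear_combination (-(ω * f s)) * this

/-- When the net weight is positive at `a`, no strategy reaching the horizon with debt left has
smaller net cost than paying at the maximal rate up to `a ≤ t*`. -/
lemma net_cost_max_le {r β T ω a tstar : ℝ} {m M α : ℝ → ℝ} (hβ : 0 < β) (hω : 0 < ω)
    (hm0 : ∀ t ∈ Icc (0:ℝ) T, 0 < m t) (hmInt : IntegrableOn m (Icc 0 T))
    (hMInt : IntegrableOn M (Icc 0 T)) (hα : α ∈ Adm T m M)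
    (htstar : tstar ∈ Icc (tCrit β T ω) T)
    (htstarEq :
      (∫ s in (tCrit β T ω)..tstar,
        Real.exp (-r * s) * M s * (1 - ω * Real.exp (β * (T - s))))
      = ∫ s in (tCrit β T ω)..T,
        Real.exp (-r * s) * m s * (1 - ω * Real.exp (β * (T - s))))
    (hca : tCrit β T ω ≤ a) (ha : a ≤ tstar) :
    (∫ s in (0:ℝ)..a, Real.exp (-r * s) * M s * (1 - ω * Real.exp (β * (T - s)))) ≤
      ∫ s in (0:ℝ)..T, Real.exp (-r * s) * α s * (1 - ω * Real.exp (β * (T - s))) := by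
  have hαInt := Adm.integrableOn hMInt hm0 hα
  have hc0 := tCrit_nonneg β T ω
  have m0 : (0:ℝ) ∈ Icc 0 T := ⟨le_rfl, hc0.trans (htstar.1.trans htstar.2)⟩
  have mT : T ∈ Icc 0 T := ⟨m0.2, le_rfl⟩
  have mc : tCrit β T ω ∈ Icc 0 T := ⟨hc0, htstar.1.trans htstar.2⟩
  have ma : a ∈ Icc 0 T := ⟨hc0.trans hca, ha.trans htstar.2⟩
  have ms : tstar ∈ Icc 0 T := ⟨hc0.trans htstar.1, htstar.2⟩
  have hI : ∀ {f : ℝ → ℝ} {u v : ℝ}, IntegrableOn f (Icc 0 T) → u ∈ Icc 0 T → v ∈ Icc 0 T →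
      IntervalIntegrable (fun s => Real.exp (-r * s) * f s * (1 - ω * Real.exp (β * (T - s))))
        volume u v := fun {f} {u} {v} hf hu hv => by
    have := intervalIntegrable_continuous_mul
      (h := fun s => Real.exp (-r * s) * (1 - ω * Real.exp (β * (T - s)))) hf (by fun_prop) hu hv
    exact this.congr (fun s _ => by ring)
  have h1 : (∫ s in (0:ℝ)..tCrit β T ω,
        Real.exp (-r * s) * M s * (1 - ω * Real.exp (β * (T - s)))) ≤
      ∫ s in (0:ℝ)..tCrit β T ω,
        Real.exp (-r * s) * α s * (1 - ω * Real.exp (β * (T - s))) := by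
    refine intervalIntegral.integral_mono_on_of_le_Ioo hc0 (hI hMInt m0 mc) (hI hαInt m0 mc)
      fun s hs => ?_
    refine mul_le_mul_of_nonpos_right ?_ (net_weight_nonpos_of_lt_tCrit hβ hω hs.1.le hs.2)
    gcongr
    exact (hα.2 s ⟨hs.1.le, hs.2.le.trans mc.2⟩).2
  have h2 : (∫ s in (tCrit β T ω)..T,
        Real.exp (-r * s) * m s * (1 - ω * Real.exp (β * (T - s)))) ≤
      ∫ s in (tCrit β T ω)..T,
        Real.exp (-r * s) * α s * (1 - ω * Real.exp (β * (T - s))) := by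
    refine intervalIntegral.integral_mono_on mc.2 (hI hmInt mc mT) (hI hαInt mc mT)
      fun s hs => ?_
    refine mul_le_mul_of_nonneg_right ?_ (net_weight_nonneg_of_tCrit_le hβ hω hs.1)
    gcongr
    exact (hα.2 s ⟨hc0.trans hs.1, hs.2⟩).1
  have h3 : 0 ≤ ∫ s in a..tstar,
      Real.exp (-r * s) * M s * (1 - ω * Real.exp (β * (T - s))) := by
    refine intervalIntegral.integral_nonneg ha fun s hs => ?_
    have hs' : s ∈ Icc 0 T := ⟨ma.1.trans hs.1, hs.2.trans ms.2⟩
    have hMs : 0 ≤ M s := (hm0 s hs').le.trans ((hα.2 s hs').1.trans (hα.2 s hs').2)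
    exact mul_nonneg (mul_nonneg (Real.exp_pos _).le hMs)
      (net_weight_nonneg_of_tCrit_le hβ hω (hca.trans hs.1))
  have e1 := intervalIntegral.integral_add_adjacent_intervals (hI hMInt m0 mc) (hI hMInt mc ma)
  have e2 := intervalIntegral.integral_add_adjacent_intervals (hI hMInt mc ma) (hI hMInt ma ms)
  have e3 := intervalIntegral.integral_add_adjacent_intervals (hI hαInt m0 mc) (hI hαInt mc mT)
  linarith

/-- for `0 < x ≤ x*`, the max strategy attains the infimum defining
`v(x)`, and `v(x) = v₂(x) = ∫_0^{t_M} e^{-rs} M(s) ds`. -/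
theorem stmt1 (r β T ω : ℝ) (m M : ℝ → ℝ)
    (hr : 0 < r) (hβ : 0 < β) (hT : 0 < T) (hω : ω ∈ Ioo (0:ℝ) 1)
    (hmMeas : Measurable m) (hMMeas : Measurable M)
    (hmInt : IntegrableOn m (Icc (0:ℝ) T)) (hMInt : IntegrableOn M (Icc (0:ℝ) T))
    (hmM : ∀ t ∈ Icc (0:ℝ) T, 0 < m t ∧ m t < M t)
    (tstar : ℝ) (htstar : tstar ∈ Ioo (tCrit β T ω) T)
    (htstarEq :
      (∫ s in (tCrit β T ω)..tstar,
        Real.exp (-r * s) * M s * (1 - ω * Real.exp (β * (T - s))))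
      = ∫ s in (tCrit β T ω)..T,
        Real.exp (-r * s) * m s * (1 - ω * Real.exp (β * (T - s))))
    (x : ℝ) (hx0 : 0 < x)
    (hx : x ≤ ∫ s in (0:ℝ)..tstar, Real.exp (-(r + β) * s) * M s)
    (tM : ℝ) (htM : tM ∈ Ioc (0:ℝ) T)
    (htMEq : x = ∫ s in (0:ℝ)..tM, Real.exp (-(r + β) * s) * M s)
    (htMuniq : ∀ t' ∈ Ioc (0:ℝ) T,
      x = (∫ s in (0:ℝ)..t', Real.exp (-(r + β) * s) * M s) → t' = tM) :
    M ∈ Adm T m M ∧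
    costC r β T ω x M = valC r β T ω m M x ∧
    valC r β T ω m M x = ∫ s in (0:ℝ)..tM, Real.exp (-r * s) * M s := by
  have hm0 : ∀ t ∈ Icc (0:ℝ) T, 0 < m t := fun t ht => (hmM t ht).1
  have hMAdm : M ∈ Adm T m M := ⟨hMMeas, fun t ht => ⟨(hmM t ht).2.le, le_rfl⟩⟩
  have mM : tM ∈ Icc 0 T := ⟨htM.1.le, htM.2⟩
  have m0 : (0:ℝ) ∈ Icc 0 T := ⟨le_rfl, hT.le⟩
  have hI : ∀ {f : ℝ → ℝ} {u v : ℝ}, IntegrableOn f (Icc 0 T) → u ∈ Icc 0 T → v ∈ Icc 0 T →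
      IntervalIntegrable (fun s => Real.exp (-(r + β) * s) * f s) volume u v :=
    fun hf hu hv => intervalIntegrable_continuous_mul hf (by fun_prop) hu hv
  have hmono : ∀ {u v : ℝ}, 0 ≤ u → u ≤ v → v ≤ T →
      (∫ s in (0:ℝ)..u, Real.exp (-(r + β) * s) * M s) ≤
        ∫ s in (0:ℝ)..v, Real.exp (-(r + β) * s) * M s := by
    intro u v hu huv hv
    have mu : u ∈ Icc 0 T := ⟨hu, huv.trans hv⟩
    have mv : v ∈ Icc 0 T := ⟨hu.trans huv, hv⟩
    rw [← intervalIntegral.integral_add_adjacent_intervals (hI hMInt m0 mu) (hI hMInt mu mv)]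
    refine le_add_of_nonneg_right (intervalIntegral.integral_nonneg huv fun s hs => ?_)
    have hs' := hmM s ⟨hu.trans hs.1, hs.2.trans hv⟩
    exact mul_nonneg (Real.exp_pos _).le (hs'.1.trans hs'.2).le
  have hzeroM : balC r β x M tM = 0 := balC_eq_zero_iff.2 htMEq.symm
  have hτM : tauC r β T x M = tM := by
    refine le_antisymm (tauC_le hT.le mM hzeroM) (le_csInf (insert_nonempty _ _) ?_)
    rintro t (rfl | ⟨ht, h0⟩)
    · exact htM.2
    · rw [balC_eq_zero_iff] at h0
      have htne : 0 ≠ t := by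
        rintro rfl
        simp at h0
        exact hx0.ne h0
      exact (htMuniq t ⟨lt_of_le_of_ne ht.1 htne, ht.2⟩ h0.symm).ge
  have hcostM : costC r β T ω x M = ∫ s in (0:ℝ)..tM, Real.exp (-r * s) * M s := by
    rw [costC, hτM, hzeroM, mul_zero, add_zero]
  have htMs : tM ≤ tstar := by
    by_contra! hlt
    have hs0 : 0 < tstar := (tCrit_nonneg β T ω).trans_lt htstar.1
    have := hmono hs0.le hlt.le htM.2
    exact hlt.ne (htMuniq tstar ⟨hs0, htstar.2.le⟩ (by linarith))
  have hlower : ∀ α ∈ Adm T m M,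
      (∫ s in (0:ℝ)..tM, Real.exp (-r * s) * M s) ≤ costC r β T ω x α := by
    intro α hα
    have hαInt := Adm.integrableOn hMInt hm0 hα
    have hα0 : ∀ t ∈ Icc (0:ℝ) T, 0 ≤ α t := fun t ht => (hm0 t ht).le.trans (hα.2 t ht).1
    have hαM : ∀ t ∈ Icc (0:ℝ) T, α t ≤ M t := fun t ht => (hα.2 t ht).2
    rcases tauC_spec (r := r) (β := β) hT.le hx0 hαInt with ⟨hτ, h0⟩ | ⟨hτ, hle⟩
    · rw [costC, h0, mul_zero, add_zero]
      rw [balC_eq_zero_iff] at h0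
      generalize tauC r β T x α = τ at hτ h0 ⊢
      have hMτ : tM ≤ τ := by
        by_contra! hlt
        have hτne : 0 ≠ τ := by
          rintro rfl
          simp at h0
          exact hx0.ne h0
        have h1 := hmono hτ.1 hlt.le htM.2
        have h2 : (∫ s in (0:ℝ)..τ, Real.exp (-(r + β) * s) * α s) ≤
            ∫ s in (0:ℝ)..τ, Real.exp (-(r + β) * s) * M s := by
          refine intervalIntegral.integral_mono_on hτ.1 (hI hαInt m0 hτ) (hI hMInt m0 hτ)
            fun s hs => ?_
          gcongr
          exact hαM s ⟨hs.1, hs.2.trans hτ.2⟩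
        exact hlt.ne (htMuniq τ ⟨lt_of_le_of_ne hτ.1 hτne, hτ.2⟩ (by linarith))
      have := rearrangement_le (r := r) hβ hαInt hMInt hα0 hαM mM.1 hMτ hτ.2
      rw [h0, ← htMEq, sub_self, mul_zero] at this
      linarith
    · have hexp : Real.exp (-r * T) * Real.exp ((r + β) * T) = Real.exp (β * T) := by
        rw [← Real.exp_add]
        ring_nf
      have hcost : costC r β T ω x α = (∫ s in (0:ℝ)..T, Real.exp (-r * s) * α s) +
          ω * Real.exp (β * T) * (x - ∫ s in (0:ℝ)..T, Real.exp (-(r + β) * s) * α s) := by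
        rw [costC, hτ, balC, ← hexp]
        ring
      rw [hcost]
      rcases le_or_gt (Real.exp (β * tM)) (ω * Real.exp (β * T)) with hq | hq
      · have := rearrangement_le (r := r) hβ hαInt hMInt hα0 hαM mM.1 htM.2 le_rfl
        rw [← htMEq] at this
        have := mul_le_mul_of_nonneg_right hq (sub_nonneg.2 hle)
        linarith
      · have hca : tCrit β T ω ≤ tM := by
          by_contra! hlt
          have h := net_weight_nonpos_of_lt_tCrit hβ hω.1 mM.1 hlt
          have hE : Real.exp (β * tM) * Real.exp (β * (T - tM)) = Real.exp (β * T) := by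
            rw [← Real.exp_add]
            ring_nf
          have h' := mul_le_mul_of_nonneg_left h (Real.exp_pos (β * tM)).le
          have : Real.exp (β * tM) * (1 - ω * Real.exp (β * (T - tM))) =
              Real.exp (β * tM) - ω * Real.exp (β * T) := by
            rw [← hE]
            ring
          linarith
        have := net_cost_max_le hβ hω.1 hm0 hmInt hMInt hα ⟨htstar.1.le, htstar.2.le⟩ htstarEq
          hca htMs
        rw [integral_net_cost hMInt m0 mM, integral_net_cost hαInt m0 (right_mem_Icc.2 hT.le),
          ← htMEq] at this
        linarith
  have hval : valC r β T ω m M x = ∫ s in (0:ℝ)..tM, Real.exp (-r * s) * M s := by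
    refine IsLeast.csInf_eq ⟨⟨M, hMAdm, hcostM⟩, ?_⟩
    rintro _ ⟨α, hα, rfl⟩
    exact hlower α hα
  exact ⟨hMAdm, hcostM.trans hval.symm, hval⟩
end
end

section
/- If x > x̄ := ∫_0^T e^{−(r+β)s} M(s) ds, then the strategy α*(t) := M(t)·1_{[0,t_c]}(t) + m(t)·1_{(t_c,T]}(t) attains the infimum defining v(x); moreover τ(α*) = T and v(x) = v1(x). -/
open MeasureTheory Set

noncomputable section

lemma intervalIntegrable_mul_of_mem_Adm {T : ℝ} {m M α c : ℝ → ℝ} (hα : α ∈ Adm T m M)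
    (hc : Continuous c) (hMInt : IntegrableOn M (Icc (0:ℝ) T))
    (hm : ∀ t ∈ Icc (0:ℝ) T, 0 ≤ m t) {a b : ℝ} (ha : a ∈ Icc (0:ℝ) T) (hb : b ∈ Icc (0:ℝ) T) :
    IntervalIntegrable (fun s => c s * α s) volume a b := by
  have hInt : IntegrableOn α (Icc (0:ℝ) T) := by
    refine Integrable.mono' hMInt hα.1.aestronglyMeasurable ?_
    refine (ae_restrict_iff' measurableSet_Icc).2 (ae_of_all _ fun t ht => ?_)
    rw [Real.norm_of_nonneg ((hm t ht).trans (hα.2 t ht).1)]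
    exact (hα.2 t ht).2
  have h : IntervalIntegrable α volume a b :=
    (hInt.mono_set (uIcc_subset_Icc ha hb)).intervalIntegrable
  exact h.continuousOn_mul hc.continuousOn

lemma balC_pos_of_mem_Adm {r β T x : ℝ} {m M α : ℝ → ℝ} (hM : M ∈ Adm T m M)
    (hMInt : IntegrableOn M (Icc (0:ℝ) T)) (hm : ∀ t ∈ Icc (0:ℝ) T, 0 ≤ m t)
    (hx : xBar r β T M < x) (hα : α ∈ Adm T m M) {t : ℝ} (ht : t ∈ Icc (0:ℝ) T) :
    0 < balC r β x α t := by
  have hT : (0:ℝ) ≤ T := ht.1.trans ht.2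
  have h0 : (0:ℝ) ∈ Icc (0:ℝ) T := ⟨le_rfl, hT⟩
  have hTT : T ∈ Icc (0:ℝ) T := ⟨hT, le_rfl⟩
  have hc : Continuous fun s : ℝ => Real.exp (-(r + β) * s) := by fun_prop
  have h1 : ∫ s in (0:ℝ)..t, Real.exp (-(r + β) * s) * α s
      ≤ ∫ s in (0:ℝ)..t, Real.exp (-(r + β) * s) * M s :=
    intervalIntegral.integral_mono_on ht.1
      (intervalIntegrable_mul_of_mem_Adm hα hc hMInt hm h0 ht)
      (intervalIntegrable_mul_of_mem_Adm hM hc hMInt hm h0 ht)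
      fun s hs => mul_le_mul_of_nonneg_left (hα.2 s ⟨hs.1, hs.2.trans ht.2⟩).2 (Real.exp_pos _).le
  have h2 : 0 ≤ ∫ s in t..T, Real.exp (-(r + β) * s) * M s :=
    intervalIntegral.integral_nonneg ht.2 fun s hs => by
      have hs' : s ∈ Icc (0:ℝ) T := ⟨ht.1.trans hs.1, hs.2⟩
      exact mul_nonneg (Real.exp_pos _).le ((hm s hs').trans (hM.2 s hs').1)
  have h3 := intervalIntegral.integral_add_adjacent_intervals
    (intervalIntegrable_mul_of_mem_Adm hM hc hMInt hm h0 ht) (intervalIntegrable_mul_of_mem_Adm hM hc hMInt hm ht hTT)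
  unfold xBar at hx
  exact mul_pos (Real.exp_pos _) (by linarith)

lemma tauC_eq_of_balC_pos {r β T x : ℝ} {α : ℝ → ℝ}
    (h : ∀ t ∈ Icc (0:ℝ) T, 0 < balC r β x α t) : tauC r β T x α = T := by
  have : {t | t ∈ Icc (0:ℝ) T ∧ balC r β x α t = 0} = ∅ :=
    eq_empty_of_forall_notMem fun t ht => (h t ht.1).ne' ht.2
  rw [tauC, this, insert_empty_eq, csInf_singleton]

lemma costC_eq_of_tauC_eq {r β T ω x : ℝ} {α : ℝ → ℝ} (h : tauC r β T x α = T) :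
    costC r β T ω x α = (∫ t in (0:ℝ)..T, Real.exp (-r * t) * α t)
      + ω * Real.exp (β * T) * (x - ∫ s in (0:ℝ)..T, Real.exp (-(r + β) * s) * α s) := by
  have he : Real.exp (β * T) = Real.exp (-r * T) * Real.exp ((r + β) * T) := by
    rw [← Real.exp_add]; ring_nf
  rw [costC, h, balC, he]; ring

lemma tCrit_mem_Icc {β T ω : ℝ} (hβ : 0 < β) (hT : 0 < T) (hω : ω ∈ Ioo (0:ℝ) 1) :
    tCrit β T ω ∈ Icc (0:ℝ) T := by
  refine ⟨le_max_right _ _, max_le ?_ hT.le⟩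
  have := div_neg_of_neg_of_pos (Real.log_neg hω.1 hω.2) hβ
  linarith

/-- The coefficient of `α t` in the cost of a strategy that never empties the balance. -/
def costWeight (r β T ω t : ℝ) : ℝ :=
  Real.exp (-r * t) - ω * Real.exp (β * T) * Real.exp (-(r + β) * t)

lemma costWeight_eq {r β T ω t : ℝ} (hω : 0 < ω) :
    costWeight r β T ω t
      = Real.exp (-r * t) * (1 - Real.exp (Real.log ω + β * (T - t))) := by
  have h : Real.exp (-(r + β) * t) = Real.exp (-r * t) * Real.exp (-(β * t)) := by
    rw [← Real.exp_add]; ring_nf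
  have h' : Real.exp (Real.log ω + β * (T - t))
      = ω * (Real.exp (β * T) * Real.exp (-(β * t))) := by
    rw [← Real.exp_add, Real.exp_add (Real.log ω), Real.exp_log hω]; ring_nf
  rw [costWeight, h, h']; ring

lemma costWeight_nonpos {r β T ω t : ℝ} (hβ : 0 < β) (hω : 0 < ω) (h0 : 0 < t)
    (ht : t ≤ tCrit β T ω) : costWeight r β T ω t ≤ 0 := by
  rw [costWeight_eq hω]
  refine mul_nonpos_of_nonneg_of_nonpos (Real.exp_pos _).le
    (sub_nonpos.2 (Real.one_le_exp ?_))
  rcases le_max_iff.1 ht with h | h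
  · have := mul_le_mul_of_nonneg_left h hβ.le
    rw [mul_add, mul_div_cancel₀ _ hβ.ne'] at this
    linarith
  · exact absurd h0 h.not_gt

lemma costWeight_nonneg {r β T ω t : ℝ} (hβ : 0 < β) (hω : 0 < ω)
    (ht : tCrit β T ω < t) : 0 ≤ costWeight r β T ω t := by
  rw [costWeight_eq hω]
  refine mul_nonneg (Real.exp_pos _).le (sub_nonneg.2 (Real.exp_le_one_iff.2 ?_))
  have := mul_le_mul_of_nonneg_left (max_lt_iff.1 ht).1.le hβ.le
  rw [mul_add, mul_div_cancel₀ _ hβ.ne'] at this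
  linarith

lemma continuous_costWeight (r β T ω : ℝ) : Continuous (costWeight r β T ω) := by
  unfold costWeight; fun_prop

lemma integral_costWeight_mul_of_mem_Adm {r β T ω : ℝ} {m M α : ℝ → ℝ}
    (hα : α ∈ Adm T m M) (hT : 0 ≤ T) (hMInt : IntegrableOn M (Icc (0:ℝ) T))
    (hm : ∀ t ∈ Icc (0:ℝ) T, 0 ≤ m t) :
    ∫ t in (0:ℝ)..T, costWeight r β T ω t * α t
      = (∫ t in (0:ℝ)..T, Real.exp (-r * t) * α t)
        - ω * Real.exp (β * T) * ∫ t in (0:ℝ)..T, Real.exp (-(r + β) * t) * α t := by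
  have h0 : (0:ℝ) ∈ Icc (0:ℝ) T := ⟨le_rfl, hT⟩
  have hTT : T ∈ Icc (0:ℝ) T := ⟨hT, le_rfl⟩
  rw [← intervalIntegral.integral_const_mul, ← intervalIntegral.integral_sub
    (intervalIntegrable_mul_of_mem_Adm hα (by fun_prop) hMInt hm h0 hTT)
    ((intervalIntegrable_mul_of_mem_Adm hα (by fun_prop) hMInt hm h0 hTT).const_mul _)]
  congr 1; ext t; rw [costWeight]; ring

lemma integral_mul_ite_of_mem_Adm {T k : ℝ} {m M c : ℝ → ℝ} (hc : Continuous c)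
    (hMInt : IntegrableOn M (Icc (0:ℝ) T)) (hm : ∀ t ∈ Icc (0:ℝ) T, 0 ≤ m t)
    (hk : k ∈ Icc (0:ℝ) T) (hα : (fun t => if t ≤ k then M t else m t) ∈ Adm T m M) :
    ∫ t in (0:ℝ)..T, c t * (if t ≤ k then M t else m t)
      = (∫ t in (0:ℝ)..k, c t * M t) + ∫ t in k..T, c t * m t := by
  have hT : (0:ℝ) ≤ T := hk.1.trans hk.2
  rw [← intervalIntegral.integral_add_adjacent_intervals
    (intervalIntegrable_mul_of_mem_Adm hα hc hMInt hm ⟨le_rfl, hT⟩ hk)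
    (intervalIntegrable_mul_of_mem_Adm hα hc hMInt hm hk ⟨hT, le_rfl⟩)]
  congr 1
  · refine intervalIntegral.integral_congr fun t ht => ?_
    rw [uIcc_of_le hk.1] at ht
    simp only [if_pos ht.2]
  · refine intervalIntegral.integral_congr_ae (ae_of_all _ fun t ht => ?_)
    rw [uIoc_of_le hk.2] at ht
    simp only [if_neg ht.1.not_ge]

/-- for `x > x̄`, the max-min strategy attains the infimum defining
`v(x)`; moreover `τ(α*) = T` and `v(x) = v₁(x)`. -/
theorem stmt4 (r β T ω : ℝ) (m M : ℝ → ℝ)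
    (hr : 0 < r) (hβ : 0 < β) (hT : 0 < T) (hω : ω ∈ Ioo (0:ℝ) 1)
    (hmMeas : Measurable m) (hMMeas : Measurable M)
    (hmInt : IntegrableOn m (Icc (0:ℝ) T)) (hMInt : IntegrableOn M (Icc (0:ℝ) T))
    (hmM : ∀ t ∈ Icc (0:ℝ) T, 0 < m t ∧ m t < M t)
    (x : ℝ) (hx : xBar r β T M < x) :
    (fun t => if t ≤ tCrit β T ω then M t else m t) ∈ Adm T m M ∧
    costC r β T ω x (fun t => if t ≤ tCrit β T ω then M t else m t)
      = valC r β T ω m M x ∧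
    tauC r β T x (fun t => if t ≤ tCrit β T ω then M t else m t) = T ∧
    valC r β T ω m M x = vOne r β T ω m M x := by
  set k := tCrit β T ω with hk_def
  set αs : ℝ → ℝ := fun t => if t ≤ k then M t else m t with hαs
  have hm : ∀ t ∈ Icc (0:ℝ) T, 0 ≤ m t := fun t ht => (hmM t ht).1.le
  have hM : M ∈ Adm T m M := ⟨hMMeas, fun t ht => ⟨(hmM t ht).2.le, le_rfl⟩⟩
  have hk : k ∈ Icc (0:ℝ) T := tCrit_mem_Icc hβ hT hω
  have hmem : αs ∈ Adm T m M := by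
    refine ⟨Measurable.ite measurableSet_Iic hMMeas hmMeas, fun t ht => ?_⟩
    have := (hmM t ht).2.le
    by_cases h : t ≤ k <;> simp [hαs, h, this]
  have htau : ∀ α ∈ Adm T m M, tauC r β T x α = T := fun α hα =>
    tauC_eq_of_balC_pos fun t ht => balC_pos_of_mem_Adm hM hMInt hm hx hα ht
  have hle : ∀ α ∈ Adm T m M, costC r β T ω x αs ≤ costC r β T ω x α := by
    intro α hα
    have hcw := continuous_costWeight r β T ω
    have h0 : (0:ℝ) ∈ Icc (0:ℝ) T := ⟨le_rfl, hT.le⟩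
    have hTT : T ∈ Icc (0:ℝ) T := ⟨hT.le, le_rfl⟩
    have h := intervalIntegral.integral_mono_on_of_le_Ioo hT.le
      (intervalIntegrable_mul_of_mem_Adm hmem hcw hMInt hm h0 hTT)
      (intervalIntegrable_mul_of_mem_Adm hα hcw hMInt hm h0 hTT) fun t ht => by
        have hb := hα.2 t ⟨ht.1.le, ht.2.le⟩
        by_cases htk : t ≤ k
        · simp only [hαs, if_pos htk]
          exact mul_le_mul_of_nonpos_left hb.2 (costWeight_nonpos hβ hω.1 ht.1 htk)
        · simp only [hαs, if_neg htk]
          exact mul_le_mul_of_nonneg_left hb.1 (costWeight_nonneg hβ hω.1 (not_le.1 htk))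
    rw [integral_costWeight_mul_of_mem_Adm hmem hT.le hMInt hm,
      integral_costWeight_mul_of_mem_Adm hα hT.le hMInt hm] at h
    rw [costC_eq_of_tauC_eq (htau _ hmem), costC_eq_of_tauC_eq (htau _ hα)]
    linarith
  have hval : costC r β T ω x αs = valC r β T ω m M x := by
    refine (IsLeast.csInf_eq ⟨mem_image_of_mem _ hmem, ?_⟩).symm
    rintro _ ⟨α, hα, rfl⟩
    exact hle α hα
  refine ⟨hmem, hval, htau _ hmem, ?_⟩
  rw [← hval, costC_eq_of_tauC_eq (htau _ hmem), vOne, ← hk_def,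
    integral_mul_ite_of_mem_Adm (by fun_prop) hMInt hm hk hmem,
    integral_mul_ite_of_mem_Adm (by fun_prop) hMInt hm hk hmem]
  ring
end
end

section
/- There exists a unique x* ∈ (x̂, x̄) such that v1(x*) = v2(x*); moreover v1(x) > v2(x) for x ∈ [x̂, x*), v1(x) < v2(x) for x ∈ (x*, x̄], x* = ∫_0^{t*} e^{−(r+β)s} M(s) ds where t* ∈ (t_c, T) is the unique solution of ∫_{t_c}^{t*} e^{−rs} M(s)(1 − ω e^{β(T−s)}) ds = ∫_{t_c}^{T} e^{−rs} m(s)(1 − ω e^{β(T−s)}) ds, and x* > x_c := ∫_0^{t_c} e^{−(r+β)s} M(s) ds + ∫_{t_c}^T e^{−(r+β)s} m(s) ds. -/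
open MeasureTheory Set

noncomputable section

/-- The primitive of an integrable function that is positive on the open interval is strictly
increasing. -/
theorem strictMonoOn_integral_of_pos_on {f : ℝ → ℝ} {a b : ℝ}
    (hf : IntervalIntegrable f volume a b) (hpos : ∀ s ∈ Ioo a b, 0 < f s) :
    StrictMonoOn (fun t => ∫ s in a..t, f s) (Icc a b) := by
  intro u hu v hv huv
  have hau : IntervalIntegrable f volume a u := hf.mono_set (by
    rw [uIcc_of_le hu.1, uIcc_of_le (hu.1.trans hu.2)]; exact Icc_subset_Icc_right hu.2)
  have huv' : IntervalIntegrable f volume u v := hf.mono_set (by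
    rw [uIcc_of_le huv.le, uIcc_of_le (hu.1.trans hu.2)]; exact Icc_subset_Icc hu.1 hv.2)
  have h := intervalIntegral.intervalIntegral_pos_of_pos_on huv'
    (fun s hs => hpos s ⟨hu.1.trans_lt hs.1, hs.2.trans_le hv.2⟩) huv
  have h' := intervalIntegral.integral_add_adjacent_intervals hau huv'
  show (∫ s in a..u, f s) < ∫ s in a..v, f s
  linarith

theorem tCrit_mem_Ico {β T ω : ℝ} (hβ : 0 < β) (hT : 0 < T) (hω : ω ∈ Ioo (0:ℝ) 1) :
    tCrit β T ω ∈ Ico 0 T := by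
  refine ⟨le_max_right _ _, max_lt ?_ hT⟩
  have := div_neg_of_neg_of_pos (Real.log_neg hω.1 hω.2) hβ
  linarith

/-- Past the critical horizon, the discounted penalty weight is less than one. -/
theorem one_sub_penalty_pos {β T ω s : ℝ} (hβ : 0 < β) (hω : 0 < ω) (hs : tCrit β T ω < s) :
    0 < 1 - ω * Real.exp (β * (T - s)) := by
  have h1 : T + Real.log ω / β < s := (le_max_left _ _).trans_lt hs
  have h2 : Real.log ω + β * (T - s) < 0 := by
    have h3 : β * (T + Real.log ω / β) < β * s := mul_lt_mul_of_pos_left h1 hβ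
    have h4 : β * (Real.log ω / β) = Real.log ω := by field_simp
    nlinarith
  have h5 := Real.exp_lt_one_iff.2 h2
  rw [Real.exp_add, Real.exp_log hω] at h5
  linarith

/-- The balance discount is the cost discount times a decreasing multiple of the weight
`1 - ω e^{β(T-s)}`: comparison of the two at times `s < t`. -/
theorem discount_mul_weight_lt {r β T ω s t : ℝ} (hβ : 0 < β) (hst : s < t) :
    Real.exp (-(β * t)) * (Real.exp (-r * s) * (1 - ω * Real.exp (β * (T - s))))
      < Real.exp (-(r + β) * s) * (1 - ω * Real.exp (β * (T - t))) := by
  have e1 : Real.exp (-(r + β) * s) = Real.exp (-r * s) * Real.exp (-(β * s)) := by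
    rw [← Real.exp_add]; ring_nf
  have e2 : ∀ u, Real.exp (β * (T - u)) = Real.exp (β * T) * Real.exp (-(β * u)) := by
    intro u; rw [← Real.exp_add]; ring_nf
  have hlt : Real.exp (-(β * t)) < Real.exp (-(β * s)) :=
    Real.exp_lt_exp.2 (neg_lt_neg (mul_lt_mul_of_pos_left hst hβ))
  rw [e1, e2, e2]
  have := mul_lt_mul_of_pos_left hlt (Real.exp_pos (-r * s))
  linear_combination this

theorem discount_mul_weight_gt {r β T ω s t : ℝ} (hβ : 0 < β) (hst : t < s) :
    Real.exp (-(r + β) * s) * (1 - ω * Real.exp (β * (T - t)))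
      < Real.exp (-(β * t)) * (Real.exp (-r * s) * (1 - ω * Real.exp (β * (T - s)))) := by
  have e1 : Real.exp (-(r + β) * s) = Real.exp (-r * s) * Real.exp (-(β * s)) := by
    rw [← Real.exp_add]; ring_nf
  have e2 : ∀ u, Real.exp (β * (T - u)) = Real.exp (β * T) * Real.exp (-(β * u)) := by
    intro u; rw [← Real.exp_add]; ring_nf
  have hlt : Real.exp (-(β * s)) < Real.exp (-(β * t)) :=
    Real.exp_lt_exp.2 (neg_lt_neg (mul_lt_mul_of_pos_left hst hβ))
  rw [e1, e2, e2]
  have := mul_lt_mul_of_pos_left hlt (Real.exp_pos (-r * s))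
  linear_combination this

/-- Splitting the weighted cost integral into its discount and penalty parts. -/
theorem integral_weight_eq {r β T ω a b : ℝ} {f : ℝ → ℝ} (hf : IntervalIntegrable f volume a b) :
    (∫ s in a..b, Real.exp (-r * s) * f s * (1 - ω * Real.exp (β * (T - s))))
      = (∫ s in a..b, Real.exp (-r * s) * f s)
        - ω * Real.exp (β * T) * ∫ s in a..b, Real.exp (-(r + β) * s) * f s := by
  rw [← intervalIntegral.integral_const_mul, ← intervalIntegral.integral_sub]
  · refine intervalIntegral.integral_congr fun s _ => ?_
    have e : Real.exp (-r * s) * Real.exp (β * (T - s))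
        = Real.exp (β * T) * Real.exp (-(r + β) * s) := by
      rw [← Real.exp_add, ← Real.exp_add]; ring_nf
    linear_combination (-ω * f s) * e
  · exact hf.continuousOn_mul (by fun_prop)
  · exact (hf.continuousOn_mul (by fun_prop)).const_mul _

/-- there is a unique `x* ∈ (x̂, x̄)` with `v₁(x*) = v₂(x*)`;
`v₁ > v₂` on `[x̂, x*)`, `v₁ < v₂` on `(x*, x̄]`;
`x* = ∫_0^{t*} e^{-(r+β)s} M(s) ds` for the unique `t* ∈ (t_c,T)` solving the
critical-time equation; and `x* > x_c`. -/
theorem stmt9 (r β T ω : ℝ) (m M : ℝ → ℝ)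
    (hr : 0 < r) (hβ : 0 < β) (hT : 0 < T) (hω : ω ∈ Ioo (0:ℝ) 1)
    (hmMeas : Measurable m) (hMMeas : Measurable M)
    (hmInt : IntegrableOn m (Icc (0:ℝ) T)) (hMInt : IntegrableOn M (Icc (0:ℝ) T))
    (hmM : ∀ t ∈ Icc (0:ℝ) T, 0 < m t ∧ m t < M t)
    (tM : ℝ → ℝ)
    (htM : ∀ y ∈ Icc (xHat r β T ω M) (xBar r β T M),
      tM y ∈ Icc (0:ℝ) T ∧
      y = ∫ s in (0:ℝ)..(tM y), Real.exp (-(r + β) * s) * M s) :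
    ∃ xstar : ℝ, xstar ∈ Ioo (xHat r β T ω M) (xBar r β T M) ∧
      vOne r β T ω m M xstar
        = (∫ s in (0:ℝ)..(tM xstar), Real.exp (-r * s) * M s) ∧
      (∀ y ∈ Ioo (xHat r β T ω M) (xBar r β T M),
        vOne r β T ω m M y = (∫ s in (0:ℝ)..(tM y), Real.exp (-r * s) * M s) →
        y = xstar) ∧
      (∀ y ∈ Ico (xHat r β T ω M) xstar,
        (∫ s in (0:ℝ)..(tM y), Real.exp (-r * s) * M s) < vOne r β T ω m M y) ∧
      (∀ y ∈ Ioc xstar (xBar r β T M),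
        vOne r β T ω m M y < ∫ s in (0:ℝ)..(tM y), Real.exp (-r * s) * M s) ∧
      (∃ tstar : ℝ, tstar ∈ Ioo (tCrit β T ω) T ∧
        ((∫ s in (tCrit β T ω)..tstar,
            Real.exp (-r * s) * M s * (1 - ω * Real.exp (β * (T - s))))
          = ∫ s in (tCrit β T ω)..T,
            Real.exp (-r * s) * m s * (1 - ω * Real.exp (β * (T - s)))) ∧
        (∀ t' ∈ Ioo (tCrit β T ω) T,
          ((∫ s in (tCrit β T ω)..t',
              Real.exp (-r * s) * M s * (1 - ω * Real.exp (β * (T - s))))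
            = ∫ s in (tCrit β T ω)..T,
              Real.exp (-r * s) * m s * (1 - ω * Real.exp (β * (T - s)))) →
          t' = tstar) ∧
        xstar = ∫ s in (0:ℝ)..tstar, Real.exp (-(r + β) * s) * M s) ∧
      xCrit r β T ω m M < xstar := by
  obtain ⟨hω0, hω1⟩ := hω
  obtain ⟨hc0, hcT⟩ := tCrit_mem_Ico hβ hT ⟨hω0, hω1⟩
  have hw : ∀ s, tCrit β T ω < s → 0 < 1 - ω * Real.exp (β * (T - s)) :=
    fun s hs => one_sub_penalty_pos hβ hω0 hs
  unfold xCrit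
  simp only [vOne, xHat, xBar] at htM ⊢
  set c := tCrit β T ω with hc
  have sub : ∀ a ∈ Icc 0 T, ∀ b ∈ Icc 0 T, uIcc a b ⊆ uIcc 0 T := by
    intro a ha b hb
    rw [uIcc_of_le hT.le]
    exact (convex_Icc 0 T).ordConnected.uIcc_subset ha hb
  have hM0 : IntervalIntegrable M volume 0 T :=
    (intervalIntegrable_iff_integrableOn_Icc_of_le hT.le).2 hMInt
  have hm0 : IntervalIntegrable m volume 0 T :=
    (intervalIntegrable_iff_integrableOn_Icc_of_le hT.le).2 hmInt
  have iM : ∀ a ∈ Icc 0 T, ∀ b ∈ Icc 0 T, IntervalIntegrable M volume a b :=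
    fun a ha b hb => hM0.mono_set (sub a ha b hb)
  have im : ∀ a ∈ Icc 0 T, ∀ b ∈ Icc 0 T, IntervalIntegrable m volume a b :=
    fun a ha b hb => hm0.mono_set (sub a ha b hb)
  have hcI : c ∈ Icc 0 T := ⟨hc0, hcT.le⟩
  have h0I : (0:ℝ) ∈ Icc 0 T := ⟨le_rfl, hT.le⟩
  have hTI : T ∈ Icc 0 T := ⟨hT.le, le_rfl⟩
  have iMx : ∀ k, ∀ a ∈ Icc 0 T, ∀ b ∈ Icc 0 T,
      IntervalIntegrable (fun s => Real.exp (k * s) * M s) volume a b :=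
    fun k a ha b hb => (iM a ha b hb).continuousOn_mul (by fun_prop)
  have imx : ∀ k, ∀ a ∈ Icc 0 T, ∀ b ∈ Icc 0 T,
      IntervalIntegrable (fun s => Real.exp (k * s) * m s) volume a b :=
    fun k a ha b hb => (im a ha b hb).continuousOn_mul (by fun_prop)
  have iMw : ∀ a ∈ Icc 0 T, ∀ b ∈ Icc 0 T, IntervalIntegrable
      (fun s => Real.exp (-r * s) * M s * (1 - ω * Real.exp (β * (T - s)))) volume a b :=
    fun a ha b hb => (iMx _ a ha b hb).mul_continuousOn (by fun_prop)
  have imw : ∀ a ∈ Icc 0 T, ∀ b ∈ Icc 0 T, IntervalIntegrable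
      (fun s => Real.exp (-r * s) * m s * (1 - ω * Real.exp (β * (T - s)))) volume a b :=
    fun a ha b hb => (imx _ a ha b hb).mul_continuousOn (by fun_prop)
  have mpos : ∀ s ∈ Icc 0 T, 0 < m s := fun s hs => (hmM s hs).1
  have Mpos : ∀ s ∈ Icc 0 T, 0 < M s := fun s hs => (mpos s hs).trans (hmM s hs).2
  have hX : StrictMonoOn (fun t => ∫ s in (0:ℝ)..t, Real.exp (-(r + β) * s) * M s) (Icc 0 T) :=
    strictMonoOn_integral_of_pos_on (iMx _ 0 h0I T hTI)
      fun s hs => mul_pos (Real.exp_pos _) (Mpos s (Ioo_subset_Icc_self hs))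
  set H : ℝ → ℝ := fun t => ∫ s in c..t,
    Real.exp (-r * s) * M s * (1 - ω * Real.exp (β * (T - s))) with hHdef
  have hH : StrictMonoOn H (Icc c T) :=
    strictMonoOn_integral_of_pos_on (iMw c hcI T hTI) fun s hs =>
      mul_pos (mul_pos (Real.exp_pos _) (Mpos s ⟨hc0.trans hs.1.le, hs.2.le⟩)) (hw s hs.1)
  have hHcont : ContinuousOn H (Icc c T) := by
    have := intervalIntegral.continuousOn_primitive_interval' (iMw c hcI T hTI)
      left_mem_uIcc
    rwa [uIcc_of_le hcT.le] at this
  set G : ℝ := ∫ s in c..T,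
    Real.exp (-r * s) * m s * (1 - ω * Real.exp (β * (T - s))) with hG
  have hG0 : H c < G := by
    rw [hHdef]
    simp only [intervalIntegral.integral_same]
    exact intervalIntegral.intervalIntegral_pos_of_pos_on (imw c hcI T hTI) (fun s hs =>
      mul_pos (mul_pos (Real.exp_pos _) (mpos s ⟨hc0.trans hs.1.le, hs.2.le⟩)) (hw s hs.1)) hcT
  have hGT : G < H T := by
    have h := intervalIntegral.intervalIntegral_pos_of_pos_on
      ((iMw c hcI T hTI).sub (imw c hcI T hTI)) (fun s hs => by
        have h1 := hmM s ⟨hc0.trans hs.1.le, hs.2.le⟩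
        have h2 := mul_pos (mul_pos (Real.exp_pos (-r * s)) (sub_pos.2 h1.2)) (hw s hs.1)
        linear_combination h2) hcT
    rw [intervalIntegral.integral_sub (iMw c hcI T hTI) (imw c hcI T hTI)] at h
    exact sub_pos.1 h
  obtain ⟨ts, hts, hHts⟩ := intermediate_value_Ioo hcT.le hHcont ⟨hG0, hGT⟩
  have htsI : ts ∈ Icc 0 T := ⟨hc0.trans hts.1.le, hts.2.le⟩
  have htsc : ts ∈ Icc c T := Ioo_subset_Icc_self hts
  have gap : ∀ t ∈ Icc 0 T,
      (∫ s in (0:ℝ)..t, Real.exp (-r * s) * M s)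
        - ((∫ s in (0:ℝ)..c, Real.exp (-r * s) * M s) + (∫ s in c..T, Real.exp (-r * s) * m s)
          + ω * Real.exp (β * T) * ((∫ s in (0:ℝ)..t, Real.exp (-(r + β) * s) * M s)
            - (∫ s in (0:ℝ)..c, Real.exp (-(r + β) * s) * M s)
            - ∫ s in c..T, Real.exp (-(r + β) * s) * m s)) = H t - G := by
    intro t ht
    have h1 := intervalIntegral.integral_add_adjacent_intervals
      (iMx (-r) 0 h0I c hcI) (iMx (-r) c hcI t ht)
    have h2 := intervalIntegral.integral_add_adjacent_intervals
      (iMx (-(r + β)) 0 h0I c hcI) (iMx (-(r + β)) c hcI t ht)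
    have h3 : H t = _ := integral_weight_eq (iM c hcI t ht)
    have h4 : G = _ := integral_weight_eq (im c hcI T hTI)
    rw [h3, h4, ← h1, ← h2]
    ring
  have key : ∀ y ∈ Icc (∫ s in (0:ℝ)..c, Real.exp (-(r + β) * s) * M s)
      (∫ s in (0:ℝ)..T, Real.exp (-(r + β) * s) * M s), tM y ∈ Icc c T ∧
      y = (∫ s in (0:ℝ)..(tM y), Real.exp (-(r + β) * s) * M s) ∧
      (∫ s in (0:ℝ)..(tM y), Real.exp (-r * s) * M s)
        - ((∫ s in (0:ℝ)..c, Real.exp (-r * s) * M s) + (∫ s in c..T, Real.exp (-r * s) * m s)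
          + ω * Real.exp (β * T) * (y
            - (∫ s in (0:ℝ)..c, Real.exp (-(r + β) * s) * M s)
            - ∫ s in c..T, Real.exp (-(r + β) * s) * m s)) = H (tM y) - G := by
    intro y hy
    obtain ⟨ht, hyt⟩ := htM y hy
    have hle : c ≤ tM y := (hX.le_iff_le hcI ht).1 (hy.1.trans_eq hyt)
    refine ⟨⟨hle, ht.2⟩, hyt, ?_⟩
    rw [← gap _ ht, ← hyt]
  set xs := ∫ s in (0:ℝ)..ts, Real.exp (-(r + β) * s) * M s with hxs
  have hxs1 : (∫ s in (0:ℝ)..c, Real.exp (-(r + β) * s) * M s) < xs := hX hcI htsI hts.1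
  have hxs2 : xs < ∫ s in (0:ℝ)..T, Real.exp (-(r + β) * s) * M s := hX htsI hTI hts.2
  have below : ∀ y ∈ Ico (∫ s in (0:ℝ)..c, Real.exp (-(r + β) * s) * M s) xs,
      (∫ s in (0:ℝ)..(tM y), Real.exp (-r * s) * M s) <
        (∫ s in (0:ℝ)..c, Real.exp (-r * s) * M s) + (∫ s in c..T, Real.exp (-r * s) * m s)
          + ω * Real.exp (β * T) * (y
            - (∫ s in (0:ℝ)..c, Real.exp (-(r + β) * s) * M s)
            - ∫ s in c..T, Real.exp (-(r + β) * s) * m s) := by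
    intro y hy
    obtain ⟨ht, hyt, hgap⟩ := key y ⟨hy.1, hy.2.le.trans hxs2.le⟩
    have hlt : tM y < ts :=
      (hX.lt_iff_lt ⟨hc0.trans ht.1, ht.2⟩ htsI).1 (hyt.symm.trans_lt hy.2)
    have := hH ht htsc hlt
    linarith
  have above : ∀ y ∈ Ioc xs (∫ s in (0:ℝ)..T, Real.exp (-(r + β) * s) * M s),
      (∫ s in (0:ℝ)..c, Real.exp (-r * s) * M s) + (∫ s in c..T, Real.exp (-r * s) * m s)
          + ω * Real.exp (β * T) * (y
            - (∫ s in (0:ℝ)..c, Real.exp (-(r + β) * s) * M s)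
            - ∫ s in c..T, Real.exp (-(r + β) * s) * m s)
        < ∫ s in (0:ℝ)..(tM y), Real.exp (-r * s) * M s := by
    intro y hy
    obtain ⟨ht, hyt, hgap⟩ := key y ⟨hxs1.le.trans hy.1.le, hy.2⟩
    have hlt : ts < tM y :=
      (hX.lt_iff_lt htsI ⟨hc0.trans ht.1, ht.2⟩).1 (hy.1.trans_eq hyt)
    have := hH htsc ht hlt
    linarith
  refine ⟨xs, ⟨hxs1, hxs2⟩, ?_, ?_, below, above, ⟨ts, hts, hHts, ?_, rfl⟩, ?_⟩
  · obtain ⟨ht, hyt, hgap⟩ := key xs ⟨hxs1.le, hxs2.le⟩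
    have heq : tM xs = ts := hX.injOn ⟨hc0.trans ht.1, ht.2⟩ htsI hyt.symm
    rw [heq] at hgap ⊢
    linarith
  · intro y hy hEq
    rcases lt_trichotomy y xs with h | h | h
    · exact absurd hEq (below y ⟨hy.1.le, h⟩).ne'
    · exact h
    · exact absurd hEq (above y ⟨h, hy.2.le⟩).ne
  · intro t' ht' hEq
    exact hH.injOn (Ioo_subset_Icc_self ht') htsc (hEq.trans hHts.symm)
  · set κ := 1 - ω * Real.exp (β * (T - ts)) with hκ
    set ε := Real.exp (-(β * ts)) with hε
    have hκpos : 0 < κ := hw ts hts.1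
    have hI1 : 0 < ∫ s in c..ts, (κ * (Real.exp (-(r + β) * s) * M s)
        - κ * (Real.exp (-(r + β) * s) * m s))
        - (ε * (Real.exp (-r * s) * M s * (1 - ω * Real.exp (β * (T - s))))
          - ε * (Real.exp (-r * s) * m s * (1 - ω * Real.exp (β * (T - s))))) := by
      refine intervalIntegral.intervalIntegral_pos_of_pos_on
        ((((iMx _ c hcI ts htsI).const_mul κ).sub ((imx _ c hcI ts htsI).const_mul κ)).sub
          (((iMw c hcI ts htsI).const_mul ε).sub ((imw c hcI ts htsI).const_mul ε)))
        (fun s hs => ?_) hts.1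
      have h1 := (hmM s ⟨hc0.trans hs.1.le, hs.2.le.trans hts.2.le⟩).2
      have h2 := discount_mul_weight_lt (r := r) (T := T) (ω := ω) hβ hs.2
      have h3 := mul_pos (sub_pos.2 h2) (sub_pos.2 h1)
      linear_combination h3
    have hI2 : 0 < ∫ s in ts..T,
        ε * (Real.exp (-r * s) * m s * (1 - ω * Real.exp (β * (T - s))))
          - κ * (Real.exp (-(r + β) * s) * m s) := by
      refine intervalIntegral.intervalIntegral_pos_of_pos_on
        (((imw ts htsI T hTI).const_mul ε).sub ((imx _ ts htsI T hTI).const_mul κ))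
        (fun s hs => ?_) hts.2
      have h1 := mpos s ⟨htsI.1.trans hs.1.le, hs.2.le⟩
      have h2 := discount_mul_weight_gt (r := r) (T := T) (ω := ω) hβ hs.1
      have h3 := mul_pos (sub_pos.2 h2) h1
      linear_combination h3
    rw [intervalIntegral.integral_sub
        (((iMx _ c hcI ts htsI).const_mul κ).sub ((imx _ c hcI ts htsI).const_mul κ))
        (((iMw c hcI ts htsI).const_mul ε).sub ((imw c hcI ts htsI).const_mul ε)),
      intervalIntegral.integral_sub
        ((iMx _ c hcI ts htsI).const_mul κ) ((imx _ c hcI ts htsI).const_mul κ),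
      intervalIntegral.integral_sub
        ((iMw c hcI ts htsI).const_mul ε) ((imw c hcI ts htsI).const_mul ε)] at hI1
    rw [intervalIntegral.integral_sub
        ((imw ts htsI T hTI).const_mul ε) ((imx _ ts htsI T hTI).const_mul κ)] at hI2
    simp only [intervalIntegral.integral_const_mul] at hI1 hI2
    have a1 := intervalIntegral.integral_add_adjacent_intervals
      (imw c hcI ts htsI) (imw ts htsI T hTI)
    have a2 := intervalIntegral.integral_add_adjacent_intervals
      (imx (-(r + β)) c hcI ts htsI) (imx (-(r + β)) ts htsI T hTI)
    have a3 := intervalIntegral.integral_add_adjacent_intervals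
      (iMx (-(r + β)) 0 h0I c hcI) (iMx (-(r + β)) c hcI ts htsI)
    have a4 := a1.trans (hG.symm.trans hHts.symm)
    simp only [hHdef] at a4
    rw [← a2, hxs, ← a3]
    refine add_lt_add_right (lt_of_mul_lt_mul_left ?_ hκpos.le) _
    linear_combination hI1 + hI2 + ε * a4
end
end
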